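/- Let k, m, q : ℕ with q ≤ k, let α : Fin m → Fin k → ℤ, and let T : (Fin k → ℤ) →ₗ[ℤ] (Fin m → ℤ) be the ℤ-linear map T x j = ∑ i, α j i * x i. Assume that the range of T is a direct summand of (Fin m → ℤ) (i.e. it admits a complementary submodule) and that the range of T has rank q (Module.finrank ℤ (LinearMap.range T) = q). Let Φ : (Fin k → ℂˣ) →* (Fin m → ℂˣ) be the group homomorphism Φ t j = ∏ i, (t i) ^ (α j i) (integer powers in ℂˣ). Then the kernel of Φ is isomorphic as a group to Fin (k − q) → ℂˣ, i.e. to the torus (ℂˣ)^{k−q}. -/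

import Mathlib

def torF {a b : ℕ} (M : Matrix (Fin b) (Fin a) ℤ) (t : Fin a → ℂˣ) : Fin b → ℂˣ :=
  fun j => ∏ i, (t i) ^ (M j i)

lemma torF_mul {a b c : ℕ} (M : Matrix (Fin c) (Fin b) ℤ) (N : Matrix (Fin b) (Fin a) ℤ)
    (t : Fin a → ℂˣ) : torF (M * N) t = torF M (torF N t) := by
  funext j
  simp only [torF, Matrix.mul_apply, ← Finset.prod_zpow, ← zpow_mul]
  rw [Finset.prod_comm]
  refine Finset.prod_congr rfl fun i _ => ?_
  have h : ∀ (s : Finset (Fin b)) (f : Fin b → ℤ), (t i) ^ (∑ x ∈ s, f x) = ∏ x ∈ s, (t i) ^ f x := by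
    intro s f
    induction s using Finset.induction_on with
    | empty => simp
    | insert x s hx ih => rw [Finset.sum_insert hx, Finset.prod_insert hx, zpow_add, ih]
  rw [h]
  exact Finset.prod_congr rfl fun x _ => by rw [mul_comm]

lemma torF_add {a b : ℕ} (M N : Matrix (Fin b) (Fin a) ℤ)
    (t : Fin a → ℂˣ) : torF (M + N) t = torF M t * torF N t := by
  funext j
  simp [torF, zpow_add, Finset.prod_mul_distrib]

lemma torF_zero {a b : ℕ} (t : Fin a → ℂˣ) :
    torF (0 : Matrix (Fin b) (Fin a) ℤ) t = 1 := by
  funext j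
  simp [torF]

lemma torF_at_one {a b : ℕ} (M : Matrix (Fin b) (Fin a) ℤ) : torF M 1 = 1 := by
  funext j
  simp [torF]

lemma torF_one {a : ℕ} (t : Fin a → ℂˣ) :
    torF (1 : Matrix (Fin a) (Fin a) ℤ) t = t := by
  funext j
  simp only [torF]
  rw [Finset.prod_eq_single j]
  · simp
  · intro b _ hb
    simp [Matrix.one_apply_ne hb.symm]
  · simp

lemma torF_map_mul {a b : ℕ} (M : Matrix (Fin b) (Fin a) ℤ)
    (t u : Fin a → ℂˣ) : torF M (t * u) = torF M t * torF M u := by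
  funext j
  simp [torF, mul_zpow, Finset.prod_mul_distrib]

lemma exists_split (k m q : ℕ) (T : (Fin k → ℤ) →ₗ[ℤ] (Fin m → ℤ))
    (hsummand : ∃ C : Submodule ℤ (Fin m → ℤ), IsCompl (LinearMap.range T) C)
    (hrank : Module.finrank ℤ (LinearMap.range T) = q) :
    ∃ (S : (Fin m → ℤ) →ₗ[ℤ] (Fin k → ℤ)) (I : (Fin (k - q) → ℤ) →ₗ[ℤ] (Fin k → ℤ))
      (R : (Fin k → ℤ) →ₗ[ℤ] (Fin (k - q) → ℤ)),
      R ∘ₗ I = LinearMap.id ∧ I ∘ₗ R + S ∘ₗ T = LinearMap.id ∧ T ∘ₗ I = 0 := by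
  obtain ⟨C, hC⟩ := hsummand
  obtain ⟨s, hs⟩ := Module.projective_lifting_property T.rangeRestrict LinearMap.id
    T.surjective_rangeRestrict
  have hs' : ∀ y : LinearMap.range T, T (s y) = y := fun y =>
    congrArg Subtype.val (LinearMap.congr_fun hs y)
  let p := Submodule.projectionOnto _ _ hC
  have hp : ∀ x, p (T x) = T.rangeRestrict x := fun x =>
    Submodule.projectionOnto_apply_left hC (T.rangeRestrict x)
  have hker : Module.finrank ℤ (LinearMap.ker T) = k - q := by
    have := Submodule.finrank_quotient_add_finrank (LinearMap.ker T)
    rw [T.quotKerEquivRange.finrank_eq] at this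
    simp at this
    omega
  let e : LinearMap.ker T ≃ₗ[ℤ] (Fin (k - q) → ℤ) :=
    LinearEquiv.ofFinrankEq _ _ (by simp [hker])
  let P : (Fin k → ℤ) →ₗ[ℤ] LinearMap.ker T :=
    LinearMap.codRestrict _ (LinearMap.id - s ∘ₗ T.rangeRestrict) (by
      intro x
      simp [hs'])
  refine ⟨s ∘ₗ p, (LinearMap.ker T).subtype ∘ₗ e.symm.toLinearMap, e.toLinearMap ∘ₗ P, ?_, ?_, ?_⟩
  · refine LinearMap.ext fun x => ?_
    have : P (e.symm x) = e.symm x := by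
      apply Subtype.ext
      have h0 : T.rangeRestrict (e.symm x : Fin k → ℤ) = 0 := Subtype.ext (e.symm x).2
      simp [P, h0]
    simp [this]
  · refine LinearMap.ext fun x => ?_
    simp [P, hp]
  · refine LinearMap.ext fun x => ?_
    simp


/-- Let `T : ℤᵏ → ℤᵐ` be the linear map with matrix of weight vectors `α`, and suppose that the
range of `T` is a direct summand of `ℤᵐ` of rank `q ≤ k`.  Let `Φ : (ℂˣ)ᵏ → (ℂˣ)ᵐ` be the
homomorphism `Φ t j = ∏ i, (t i) ^ (α j i)`.  Then the kernel of `Φ` (the common stabilizer of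
the points with full support for the corresponding `(ℂˣ)ᵏ`-action on `ℂᵐ`) is isomorphic to the
torus `(ℂˣ)^{k-q}`. -/
theorem stabilizer_of_torus_action_is_torus (k m q : ℕ) (hq : q ≤ k)
    (α : Fin m → Fin k → ℤ)
    (T : (Fin k → ℤ) →ₗ[ℤ] (Fin m → ℤ))
    (hT : ∀ (x : Fin k → ℤ) (j : Fin m), T x j = ∑ i, α j i * x i)
    (hsummand : ∃ C : Submodule ℤ (Fin m → ℤ), IsCompl (LinearMap.range T) C)
    (hrank : Module.finrank ℤ (LinearMap.range T) = q)
    (Φ : (Fin k → ℂˣ) →* (Fin m → ℂˣ))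
    (hΦ : ∀ (t : Fin k → ℂˣ) (j : Fin m), Φ t j = ∏ i, (t i) ^ (α j i)) :
    Nonempty (Φ.ker ≃* (Fin (k - q) → ℂˣ)) := by
  obtain ⟨S, I, R, h1, h2, h3⟩ := exists_split k m q T hsummand hrank
  have hTm : LinearMap.toMatrix' T = Matrix.of α := by
    ext j i
    simp [LinearMap.toMatrix'_apply, hT, Pi.single_apply]
  have hF : ∀ t, Φ t = torF (LinearMap.toMatrix' T) t := fun t => by
    funext j
    rw [hΦ, hTm]; rfl
  have g1 := congrArg LinearMap.toMatrix' h1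
  have g2 := congrArg LinearMap.toMatrix' h2
  have g3 := congrArg LinearMap.toMatrix' h3
  rw [LinearMap.toMatrix'_comp, LinearMap.toMatrix'_id] at g1
  rw [map_add, LinearMap.toMatrix'_comp, LinearMap.toMatrix'_comp, LinearMap.toMatrix'_id] at g2
  rw [LinearMap.toMatrix'_comp, map_zero] at g3
  refine ⟨{ toFun := fun t => torF (LinearMap.toMatrix' R) t
            invFun := fun u => ⟨torF (LinearMap.toMatrix' I) u, ?_⟩
            left_inv := ?_
            right_inv := ?_
            map_mul' := ?_ }⟩
  · rw [MonoidHom.mem_ker, hF, ← torF_mul, g3, torF_zero]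
  · rintro ⟨t, ht⟩
    apply Subtype.ext
    rw [MonoidHom.mem_ker, hF] at ht
    have := torF_one t
    rw [← g2, torF_add, torF_mul, torF_mul, ht, torF_at_one, mul_one] at this
    exact this
  · intro u
    change torF _ (torF _ u) = u
    rw [← torF_mul, g1, torF_one]
  · intro x y
    exact torF_map_mul _ _ _
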